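/- arXiv:2406.05299 — 5 statements merged into one kernel-verified Lean document; each statement's English description precedes it below -/
import Mathlib

section
/- Overturning principle: for all r ∈ ℝ, 1 - F_g(-r) ≥ e^{-r}·(1 - F_b(-r)) and F_g(-r) ≤ e^{-r}·F_b(-r). Consequently, whenever 0 < F_g(-r) and F_b(-r) < 1, one has r + D_g(r) ≥ 0 and r + D_b(r) ≤ 0, i.e., after observing a single action g (resp. b) the public belief favors state g (resp. b). -/
open MeasureTheory ProbabilityTheory Set

noncomputable section

/-- Overturning principle. For all `r`,
`1 - F_g(-r) ≥ e^{-r}·(1 - F_b(-r))` and `F_g(-r) ≤ e^{-r}·F_b(-r)`; consequently, whenever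
`0 < F_g(-r)` and `F_b(-r) < 1`, one has `r + D_g(r) ≥ 0` and `r + D_b(r) ≤ 0`. -/
theorem overturning_principle
    (μb μg : Measure ℝ) [IsProbabilityMeasure μb]
    (hμg : μg = μb.withDensity fun x => ENNReal.ofReal (Real.exp x))
    (hbint : ∫ x, Real.exp x ∂μb = 1)
    (Fb Fg : ℝ → ℝ)
    (hFb : ∀ x, Fb x = (μb (Iic x)).toReal)
    (hFg : ∀ x, Fg x = (μg (Iic x)).toReal)
    (Dg Db : ℝ → ℝ)
    (hDg : ∀ r, Dg r = Real.log ((1 - Fg (-r)) / (1 - Fb (-r))))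
    (hDb : ∀ r, Db r = Real.log (Fg (-r) / Fb (-r))) :
    ∀ r : ℝ,
      (Real.exp (-r) * (1 - Fb (-r)) ≤ 1 - Fg (-r)) ∧
      (Fg (-r) ≤ Real.exp (-r) * Fb (-r)) ∧
      (0 < Fg (-r) → Fb (-r) < 1 → 0 ≤ r + Dg r ∧ r + Db r ≤ 0) := by
  have hint : Integrable (fun x => Real.exp x) μb := by
    by_contra h
    rw [integral_undef h] at hbint
    exact zero_ne_one hbint
  have hG : ∀ x, Fg x = ∫ y in Iic x, Real.exp y ∂μb := by
    intro x
    rw [hFg, hμg, withDensity_apply _ measurableSet_Iic,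
      integral_eq_lintegral_of_nonneg_ae
        (Filter.Eventually.of_forall fun y => (Real.exp_pos y).le)
        hint.integrableOn.aestronglyMeasurable]
  have hG' : ∀ x, 1 - Fg x = ∫ y in Ioi x, Real.exp y ∂μb := by
    intro x
    have h := integral_add_compl (measurableSet_Iic (a := x)) hint
    rw [compl_Iic, hbint, ← hG] at h
    linarith
  have hB' : ∀ x, 1 - Fb x = μb.real (Ioi x) := by
    intro x
    have h := probReal_compl_eq_one_sub (μ := μb) (measurableSet_Iic (a := x))
    rw [compl_Iic] at h
    rw [h, hFb]
    rfl
  intro r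
  have h1 : Real.exp (-r) * (1 - Fb (-r)) ≤ 1 - Fg (-r) := by
    rw [hG', hB']
    have h := setIntegral_mono_on (μ := μb) (s := Ioi (-r)) (f := fun _ => Real.exp (-r))
      (g := fun y => Real.exp y) (integrable_const _).integrableOn hint.integrableOn
      measurableSet_Ioi (fun y hy => Real.exp_le_exp.2 (le_of_lt hy))
    rw [setIntegral_const, smul_eq_mul] at h
    linarith
  have h2 : Fg (-r) ≤ Real.exp (-r) * Fb (-r) := by
    rw [hG, hFb]
    have h := setIntegral_mono_on (μ := μb) (s := Iic (-r)) (g := fun _ => Real.exp (-r))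
      (f := fun y => Real.exp y) hint.integrableOn (integrable_const _).integrableOn
      measurableSet_Iic (fun y hy => Real.exp_le_exp.2 hy)
    rw [setIntegral_const, smul_eq_mul, measureReal_def] at h
    linarith
  refine ⟨h1, h2, fun hg hb => ⟨?_, ?_⟩⟩
  · have hb' : 0 < 1 - Fb (-r) := by linarith
    have h := Real.log_le_log (Real.exp_pos (-r)) ((le_div_iff₀ hb').2 h1)
    rw [Real.log_exp, ← hDg] at h
    linarith
  · have hb' : 0 < Fb (-r) := by
      by_contra hn
      have := mul_nonpos_of_nonneg_of_nonpos (Real.exp_pos (-r)).le (not_lt.1 hn)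
      linarith
    have h := Real.log_le_log (div_pos hg hb') ((div_le_iff₀ hb').2 h2)
    rw [Real.log_exp, ← hDb] at h
    linarith
end
end

section
/- Eventual monotonicity: under the tail-regularity assumption, the map φ(x) := x + D_g(x) = x + log((1 - F_g(-x))/(1 - F_b(-x))) is monotone nondecreasing on [x₀, ∞) for some x₀ ∈ ℝ. -/
open MeasureTheory ProbabilityTheory Set

noncomputable section

/-- Eventual monotonicity: under the tail-regularity assumption, the map
`φ(x) = x + D_g(x)` is monotone nondecreasing on some right half-line. -/
theorem eventual_monotonicity
    (μb μg : Measure ℝ) [IsProbabilityMeasure μb]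
    (hμg : μg = μb.withDensity fun x => ENNReal.ofReal (Real.exp x))
    (hbint : ∫ x, Real.exp x ∂μb = 1)
    (Fb Fg : ℝ → ℝ)
    (hFb : ∀ x, Fb x = (μb (Iic x)).toReal)
    (hFg : ∀ x, Fg x = (μg (Iic x)).toReal)
    (hFg01 : ∀ x, 0 < Fg x ∧ Fg x < 1)
    (hFb01 : ∀ x, 0 < Fb x ∧ Fb x < 1)
    -- tail regularity: continuous density on the left tail, bounded by ρ < 1
    (M ρ : ℝ) (hρ : ρ < 1) (fb : ℝ → ℝ) (hfbcont : ContinuousOn fb (Iic (-M)))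
    (hdens : μb.restrict (Iic (-M)) =
      ((volume : Measure ℝ).withDensity fun x => ENNReal.ofReal (fb x)).restrict (Iic (-M)))
    (hfbρ : ∀ x ≥ M, fb (-x) ≤ ρ)
    (Dg : ℝ → ℝ)
    (hDg : ∀ r, Dg r = Real.log ((1 - Fg (-r)) / (1 - Fb (-r)))) :
    ∃ x₀ : ℝ, MonotoneOn (fun x => x + Dg x) (Ici x₀) := by
  have hr1 : max ρ 0 < 1 := max_lt hρ one_pos
  have hr0 : 0 ≤ max ρ 0 := le_max_right _ _
  set r := max ρ 0 with hr
  -- Fb tends to zero at -∞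
  have hcdf : ∀ x, cdf μb x = Fb x := fun x => by
    rw [cdf_eq_real, hFb]; rfl
  have hev : ∀ᶠ x in Filter.atBot, Fb x < 1 - r := by
    have h := (tendsto_cdf_atBot μb).eventually (gt_mem_nhds (show (0 : ℝ) < 1 - r by linarith))
    filter_upwards [h] with x hx
    rw [← hcdf]; exact hx
  obtain ⟨a, ha⟩ := Filter.eventually_atBot.1 hev
  -- Fg is monotone
  have hFgmono : ∀ s t, s ≤ t → Fg s ≤ Fg t := fun s t hst => by
    have ht : μg (Iic t) ≠ ⊤ := fun h => by
      have := (hFg01 t).1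
      rw [hFg, h] at this
      simp at this
    rw [hFg, hFg]
    exact ENNReal.toReal_mono ht (measure_mono (Iic_subset_Iic.2 hst))
  -- Lipschitz bound for Fb on the left tail
  have hlip : ∀ s t, s ≤ t → t ≤ -M → Fb t - Fb s ≤ r * (t - s) := fun s t hst htM => by
    have hsub : Ioc s t ⊆ Iic (-M) := fun z hz => hz.2.trans htM
    have h1 : μb (Ioc s t) ≤ ENNReal.ofReal (r * (t - s)) := by
      have e1 : μb (Ioc s t) = μb.restrict (Iic (-M)) (Ioc s t) := by
        rw [Measure.restrict_apply measurableSet_Ioc, inter_eq_left.2 hsub]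
      rw [e1, hdens, Measure.restrict_apply measurableSet_Ioc, inter_eq_left.2 hsub,
        withDensity_apply _ measurableSet_Ioc]
      calc ∫⁻ z in Ioc s t, ENNReal.ofReal (fb z)
          ≤ ∫⁻ z in Ioc s t, ENNReal.ofReal r := by
            refine setLIntegral_mono measurable_const fun z hz => ENNReal.ofReal_le_ofReal ?_
            have hz' : z ≤ -M := hsub hz
            have := hfbρ (-z) (by linarith)
            rw [neg_neg] at this
            exact this.trans (le_max_left _ _)
        _ = ENNReal.ofReal (r * (t - s)) := by
            rw [setLIntegral_const, Real.volume_Ioc, ENNReal.ofReal_mul hr0]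
    have h2 : μb (Iic t) ≤ μb (Iic s) + μb (Ioc s t) := by
      rw [← Iic_union_Ioc_eq_Iic hst]
      exact measure_union_le _ _
    have h3 := ENNReal.toReal_mono (by finiteness) (h2.trans (add_le_add_right h1 _))
    rw [ENNReal.toReal_add (by finiteness) (by finiteness),
      ENNReal.toReal_ofReal (mul_nonneg hr0 (by linarith))] at h3
    rw [hFb, hFb]
    linarith
  refine ⟨max M (-a), fun x hx y hy hxy => ?_⟩
  have hxM : M ≤ x := (le_max_left _ _).trans hx
  have hxa : -a ≤ x := (le_max_right _ _).trans hx
  have hb := ha (-x) (by linarith)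
  have hl := hlip (-y) (-x) (by linarith) (by linarith)
  have hg := hFgmono (-y) (-x) (by linarith)
  have gx : 0 < 1 - Fg (-x) := by linarith [(hFg01 (-x)).2]
  have gy : 0 < 1 - Fg (-y) := by linarith [(hFg01 (-y)).2]
  have bx : 0 < 1 - Fb (-x) := by linarith [(hFb01 (-x)).2]
  have bY : 0 < 1 - Fb (-y) := by linarith [(hFb01 (-y)).2]
  have hlogg : Real.log (1 - Fg (-x)) ≤ Real.log (1 - Fg (-y)) :=
    Real.log_le_log gx (by linarith)
  have hlogb : Real.log (1 - Fb (-y)) - Real.log (1 - Fb (-x)) ≤ y - x := by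
    rw [← Real.log_div bY.ne' bx.ne']
    refine (Real.log_le_sub_one_of_pos (div_pos bY bx)).trans ?_
    rw [sub_le_iff_le_add, div_le_iff₀ bx]
    nlinarith [mul_nonneg (sub_nonneg.2 hxy) (show 0 ≤ 1 - Fb (-x) - r by linarith)]
  simp only [hDg]
  rw [Real.log_div gx.ne' bx.ne', Real.log_div gy.ne' bY.ne']
  linarith
end
end

section
/- Strict first-order stochastic dominance from the likelihood-ratio structure: if μ_b assigns positive measure to every nonempty open interval of ℝ, then F_g(x) < F_b(x) for every x ∈ ℝ; consequently D_g(r) > 0 and D_b(r) < 0 for every r ∈ ℝ. -/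
open MeasureTheory ProbabilityTheory Set

noncomputable section

theorem setIntegral_pos_aux (μ : Measure ℝ)
    (hfull : ∀ a b : ℝ, a < b → 0 < μ (Ioo a b)) (s : Set ℝ) (hs : MeasurableSet s)
    (f : ℝ → ℝ) (hf : Integrable f μ) (h0 : ∀ y ∈ s, 0 ≤ f y) (a b : ℝ) (hab : a < b)
    (hsub : Ioo a b ⊆ s) (hpos : ∀ y ∈ Ioo a b, 0 < f y) : 0 < ∫ y in s, f y ∂μ := by
  rw [setIntegral_pos_iff_support_of_nonneg_ae]
  · refine (hfull a b hab).trans_le (measure_mono ?_)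
    intro y hy
    exact ⟨(hpos y hy).ne', hsub hy⟩
  · exact (ae_restrict_iff' hs).2 (Filter.Eventually.of_forall h0)
  · exact hf.integrableOn

/-- Strict first-order stochastic dominance from the likelihood-ratio
structure: if `μ_b` has full support then `F_g(x) < F_b(x)` for all `x`, hence
`D_g(r) > 0` and `D_b(r) < 0` for all `r`. -/
theorem strict_fosd_of_likelihood_ratio
    (μb μg : Measure ℝ) [IsProbabilityMeasure μb]
    (hμg : μg = μb.withDensity fun x => ENNReal.ofReal (Real.exp x))
    (hbint : ∫ x, Real.exp x ∂μb = 1)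
    (hfull : ∀ a b : ℝ, a < b → 0 < μb (Ioo a b))
    (Fb Fg : ℝ → ℝ)
    (hFb : ∀ x, Fb x = (μb (Iic x)).toReal)
    (hFg : ∀ x, Fg x = (μg (Iic x)).toReal)
    (Dg Db : ℝ → ℝ)
    (hDg : ∀ r, Dg r = Real.log ((1 - Fg (-r)) / (1 - Fb (-r))))
    (hDb : ∀ r, Db r = Real.log (Fg (-r) / Fb (-r))) :
    (∀ x : ℝ, Fg x < Fb x) ∧ ∀ r : ℝ, 0 < Dg r ∧ Db r < 0 := by
  have hint : Integrable (fun x => Real.exp x) μb := by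
    by_contra h
    rw [integral_undef h] at hbint
    exact zero_ne_one hbint
  have hone : Integrable (fun _ : ℝ => (1 : ℝ)) μb := integrable_const 1
  have eb : ∀ x, Fb x = ∫ _ in Iic x, (1 : ℝ) ∂μb := by
    intro x
    rw [hFb]; simp [Measure.real]
  have eg : ∀ x, Fg x = ∫ y in Iic x, Real.exp y ∂μb := by
    intro x
    rw [hFg, hμg, withDensity_apply _ measurableSet_Iic,
      integral_eq_lintegral_of_nonneg_ae (Filter.Eventually.of_forall fun y => (Real.exp_pos y).le)
        hint.aestronglyMeasurable.restrict]
  have cb : ∀ x, Fb x + ∫ _ in Ioi x, (1 : ℝ) ∂μb = 1 := by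
    intro x
    have := integral_add_compl (measurableSet_Iic (a := x)) hone
    rw [compl_Iic, ← eb] at this
    rw [this]; simp
  have cg : ∀ x, Fg x + ∫ y in Ioi x, Real.exp y ∂μb = 1 := by
    intro x
    have := integral_add_compl (measurableSet_Iic (a := x)) hint
    rw [compl_Iic, ← eg] at this
    rw [this, hbint]
  have hlt : ∀ x : ℝ, Fg x < Fb x := by
    intro x
    rcases le_total x 0 with hx | hx
    · have h := setIntegral_pos_aux μb hfull (Iic x) measurableSet_Iic
        (fun y => 1 - Real.exp y) (hone.sub hint)
        (fun y hy => sub_nonneg.2 (Real.exp_le_one_iff.2 (le_trans hy hx)))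
        (x - 1) x (by linarith) (fun y hy => hy.2.le)
        (fun y hy => sub_pos.2 (Real.exp_lt_one_iff.2 (lt_of_lt_of_le hy.2 hx)))
      rw [integral_sub hone.integrableOn hint.integrableOn, ← eb, ← eg] at h
      linarith
    · have h := setIntegral_pos_aux μb hfull (Ioi x) measurableSet_Ioi
        (fun y => Real.exp y - 1) (hint.sub hone)
        (fun y hy => sub_nonneg.2 (Real.one_le_exp (le_trans hx (le_of_lt hy))))
        x (x + 1) (by linarith) (fun y hy => hy.1)
        (fun y hy => sub_pos.2 (Real.one_lt_exp_iff.2 (lt_of_le_of_lt hx hy.1)))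
      rw [integral_sub hint.integrableOn hone.integrableOn] at h
      linarith [cb x, cg x]
  refine ⟨hlt, fun r => ?_⟩
  have hg0 : 0 < Fg (-r) := by
    rw [eg]
    exact setIntegral_pos_aux μb hfull _ measurableSet_Iic _ hint
      (fun y _ => (Real.exp_pos y).le) (-r - 1) (-r) (by linarith) (fun y hy => hy.2.le)
      (fun y _ => Real.exp_pos y)
  have hb1 : 0 < 1 - Fb (-r) := by
    have h := setIntegral_pos_aux μb hfull (Ioi (-r)) measurableSet_Ioi _ hone
      (fun y _ => zero_le_one) (-r) (-r + 1) (by linarith) (fun y hy => hy.1)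
      (fun y _ => zero_lt_one)
    linarith [cb (-r)]
  have hl := hlt (-r)
  constructor
  · rw [hDg]
    apply Real.log_pos
    rw [one_lt_div hb1]
    linarith
  · rw [hDb]
    have hb0 : 0 < Fb (-r) := hg0.trans hl
    exact Real.log_neg (div_pos hg0 hb0) ((div_lt_one hb0).2 hl)
end
end

section
/- Uniform escape: let D : ℝ → ℝ be continuous with D(x) > 0 for all x, and let φ(x) = x + D(x). Then for every r̄ ∈ ℝ there exists t₀ ∈ ℕ such that the t₀-fold iterate satisfies φ^{t₀}(r) ≥ r̄ for all r ≥ 0. -/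
/-- Uniform escape: if `D` is continuous and everywhere positive and
`φ(x) = x + D(x)`, then for every target `rbar` there is a number of steps `t₀` after which
every starting point `r ≥ 0` has been carried above `rbar`. -/
theorem uniform_escape
    (D : ℝ → ℝ) (hD : Continuous D) (hpos : ∀ x, 0 < D x) :
    ∀ rbar : ℝ, ∃ t₀ : ℕ, ∀ r : ℝ, 0 ≤ r → rbar ≤ (fun x => x + D x)^[t₀] r := by
  intro rbar
  obtain ⟨z, -, hz⟩ := (isCompact_Icc (a := (0 : ℝ)) (b := max rbar 0)).exists_isMinOn
    ⟨0, by simp⟩ hD.continuousOn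
  have hm := hpos z
  obtain ⟨N, hN⟩ := exists_nat_ge (rbar / D z)
  rw [div_le_iff₀ hm] at hN
  refine ⟨N, fun r hr => ?_⟩
  have key : ∀ n : ℕ, 0 ≤ (fun x => x + D x)^[n] r ∧
      (rbar ≤ (fun x => x + D x)^[n] r ∨ n * D z ≤ (fun x => x + D x)^[n] r) := by
    intro n
    induction n with
    | zero => simp [hr]
    | succ n ih =>
      rw [Function.iterate_succ_apply']
      generalize (fun x => x + D x)^[n] r = y at ih
      obtain ⟨h0, h⟩ := ih
      have hy := hpos y
      refine ⟨by linarith, ?_⟩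
      by_cases hc : rbar ≤ y
      · left; linarith
      · right
        have h2 : D z ≤ D y := hz ⟨h0, le_max_of_le_left (not_le.mp hc).le⟩
        have h3 := h.resolve_left hc
        push_cast
        linarith
  rcases (key N).2 with h | h
  · exact h
  · exact hN.trans h
end

section
/- No immediate wrong herd: let (r^g_t(r)) be the deterministic sequence r^g_1(r) = r, r^g_{t+1}(r) = r^g_t(r) + D_g(r^g_t(r)). Then for every r ∈ ℝ, Σ_{t=1}^∞ F_b(-r^g_t(r)) = ∞; equivalently, the infinite product ∏_{t=1}^∞ (1 - F_b(-r^g_t(r))) equals 0. (By the symmetry F_g(x) + F_b(-x) = 1, equivalently Σ_{t=1}^∞ (1 - F_g(r^g_t(r))) = ∞.) -/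
open MeasureTheory ProbabilityTheory Filter Set

noncomputable section

/-- No immediate wrong herd: along the deterministic all-`g` public-belief
path `r^g_t(r)`, the series `Σ_t F_b(-r^g_t(r))` diverges; equivalently the infinite
product `∏_t (1 - F_b(-r^g_t(r)))` is 0, and by symmetry `Σ_t (1 - F_g(r^g_t(r)))`
diverges. -/
theorem no_immediate_wrong_herd
    (μb μg : Measure ℝ) [IsProbabilityMeasure μb]
    (hμg : μg = μb.withDensity fun x => ENNReal.ofReal (Real.exp x))
    (hbint : ∫ x, Real.exp x ∂μb = 1)
    (Fb Fg : ℝ → ℝ)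
    (hFb : ∀ x, Fb x = (μb (Iic x)).toReal)
    (hFg : ∀ x, Fg x = (μg (Iic x)).toReal)
    (hFgCont : Continuous Fg) (hFbCont : Continuous Fb)
    (hFg01 : ∀ x, 0 < Fg x ∧ Fg x < 1)
    (hFb01 : ∀ x, 0 < Fb x ∧ Fb x < 1)
    (hsym : ∀ x, Fg x + Fb (-x) = 1)
    (Dg : ℝ → ℝ)
    (hDg : ∀ r, Dg r = Real.log ((1 - Fg (-r)) / (1 - Fb (-r)))) :
    ∀ r : ℝ,
      Tendsto (fun n => ∑ t ∈ Finset.range n, Fb (-((fun x => x + Dg x)^[t] r)))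
        atTop atTop ∧
      Tendsto (fun n => ∏ t ∈ Finset.range n, (1 - Fb (-((fun x => x + Dg x)^[t] r))))
        atTop (nhds 0) ∧
      Tendsto (fun n => ∑ t ∈ Finset.range n, (1 - Fg ((fun x => x + Dg x)^[t] r)))
        atTop atTop := by
  intro r
  have hmono : Monotone Fb := by
    intro x y hxy
    rw [hFb, hFb]
    exact ENNReal.toReal_mono (measure_ne_top _ _) (measure_mono (Iic_subset_Iic.2 hxy))
  set R : ℕ → ℝ := fun t => (fun x => x + Dg x)^[t] r with hR
  have hstep : ∀ n, R (n + 1) = R n + Dg (R n) := by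
    intro n
    simp only [hR, Function.iterate_succ_apply']
  have hD : ∀ x, Dg x ≤ -Real.log (1 - Fb (-x)) := by
    intro x
    have h1 := hFg01 (-x)
    have h2 := hFb01 (-x)
    rw [hDg, Real.log_div (by linarith) (by linarith)]
    have := Real.log_nonpos (x := 1 - Fg (-x)) (by linarith) (by linarith)
    linarith
  have hbound : ∀ n, R n ≤ r + ∑ t ∈ Finset.range n, -Real.log (1 - Fb (-(R t))) := by
    intro n
    induction n with
    | zero => simp [hR]
    | succ k ih =>
      rw [hstep, Finset.sum_range_succ]
      have := hD (R k)
      linarith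
  have hns : ¬ Summable (fun t => Fb (-(R t))) := by
    intro hs
    have hl : Summable (fun t => -Real.log (1 - Fb (-(R t)))) := by
      have := (Real.summable_log_one_add_of_summable hs.neg).neg
      simpa [sub_eq_add_neg] using this
    have hub : ∀ n, R n ≤ r + ∑' t, -Real.log (1 - Fb (-(R t))) := by
      intro n
      refine (hbound n).trans ?_
      gcongr
      refine hl.sum_le_tsum _ ?_
      intro i _
      have h2 := hFb01 (-(R i))
      have := Real.log_nonpos (x := 1 - Fb (-(R i))) (by linarith) (by linarith)
      linarith
    have hc := ge_of_tendsto' hs.tendsto_atTop_zero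
      (fun n => hmono (neg_le_neg (hub n)))
    exact absurd hc (not_le.2 (hFb01 _).1)
  have hS : Tendsto (fun n => ∑ t ∈ Finset.range n, Fb (-(R t))) atTop atTop :=
    (not_summable_iff_tendsto_nat_atTop_of_nonneg (fun n => (hFb01 _).1.le)).1 hns
  refine ⟨hS, ?_, ?_⟩
  · refine squeeze_zero (g := fun n => Real.exp (-∑ t ∈ Finset.range n, Fb (-(R t)))) ?_ ?_ ?_
    · intro n
      exact Finset.prod_nonneg fun i _ => by linarith [(hFb01 (-(R i))).2]
    · intro n
      rw [← Finset.sum_neg_distrib, Real.exp_sum]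
      refine Finset.prod_le_prod (fun i _ => by linarith [(hFb01 (-(R i))).2]) ?_
      intro i _
      exact Real.one_sub_le_exp_neg _
    · exact Real.tendsto_exp_neg_atTop_nhds_zero.comp hS
  · refine hS.congr ?_
    intro n
    refine Finset.sum_congr rfl ?_
    intro i _
    linarith [hsym (R i)]
end
end
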